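/- Let A be a BV algebra over a commutative ring R, let B be a ℤ-graded R-module, and let E : A → B be an R-linear map of degree 0 and M : B → A an R-linear map of degree +1 such that E ∘ M = 0 and M ∘ E = Δ. Define the string bracket of homogeneous a, b ∈ B by [a,b] := (−1)^{|a|+1} E(Ma · Mb) (this is the bracket E(Ma • Mb) of the paper, with a standard sign convention). Then: (i) Δ ∘ M = 0 and E ∘ Δ = 0; (ii) M[a,b] = {Ma, Mb}, where {x,y} := (−1)^{|x|}(Δ(x·y) − Δx·y − (−1)^{|x|} x·Δy) is the Gerstenhaber bracket of A, so M is a morphism of brackets; (iii) [,] is graded antisymmetric, [a,b] = −(−1)^{|a||b|}[b,a], and satisfies the graded Jacobi identity [a,[b,c]] = [[a,b],c] + (−1)^{|a||b|}[b,[a,c]] for all homogeneous a, b, c ∈ B. -/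

import Mathlib

/-- The sign `(−1)^n` for `n : ℤ`, as an integer. -/
def sgn (n : ℤ) : ℤ := (((-1 : ℤˣ) ^ n : ℤˣ) : ℤ)

/-- A Batalin–Vilkovisky (BV) algebra over a commutative ring `R`. -/
structure GradedBV (R A : Type*) [CommRing R] [AddCommGroup A] [Module R A] where
  deg : ℤ → Submodule R A
  mul : A →ₗ[R] A →ₗ[R] A
  one : A
  Δ : A →ₗ[R] A
  mul_mem : ∀ {i j : ℤ} {x y : A}, x ∈ deg i → y ∈ deg j → mul x y ∈ deg (i + j)
  Δ_mem : ∀ {i : ℤ} {x : A}, x ∈ deg i → Δ x ∈ deg (i + 1)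
  mul_assoc' : ∀ x y z : A, mul (mul x y) z = mul x (mul y z)
  one_mul' : ∀ x : A, mul one x = x
  mul_one' : ∀ x : A, mul x one = x
  mul_comm' : ∀ {i j : ℤ} {x y : A}, x ∈ deg i → y ∈ deg j →
    mul x y = sgn (i * j) • mul y x
  Δ_sq : ∀ x : A, Δ (Δ x) = 0
  deviation_deriv : ∀ {i j k : ℤ} {x y z : A}, x ∈ deg i → y ∈ deg j → z ∈ deg k →
    (Δ (mul x (mul y z)) - mul (Δ x) (mul y z) - sgn i • mul x (Δ (mul y z)))
      = mul (Δ (mul x y) - mul (Δ x) y - sgn i • mul x (Δ y)) z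
        + sgn ((i + 1) * j) •
            mul y (Δ (mul x z) - mul (Δ x) z - sgn i • mul x (Δ z))

/-- The Gerstenhaber bracket `{x,y} := (−1)^{|x|} (Δ(x·y) − Δx·y − (−1)^{|x|} x·Δy)`
of the BV algebra, for `x` homogeneous of degree `i`. -/
def GradedBV.bracket {R A : Type*} [CommRing R] [AddCommGroup A] [Module R A]
    (S : GradedBV R A) (i : ℤ) (x y : A) : A :=
  sgn i • (S.Δ (S.mul x y) - S.mul (S.Δ x) y - sgn i • S.mul x (S.Δ y))

/-- The string bracket `[a,b] := (−1)^{|a|+1} E(Ma · Mb)`, for `a` homogeneous of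
degree `i`. -/
def stringBracket {R A B : Type*} [CommRing R] [AddCommGroup A] [Module R A]
    [AddCommGroup B] [Module R B] (S : GradedBV R A)
    (E : A →ₗ[R] B) (M : B →ₗ[R] A) (i : ℤ) (a b : B) : B :=
  sgn (i + 1) • E (S.mul (M a) (M b))

theorem sgn_even_aux {n : ℤ} (h : Even n) : sgn n = 1 := by
  simp [sgn, h.neg_one_zpow]

theorem sgn_odd_aux {n : ℤ} (h : Odd n) : sgn n = -1 := by
  simp [sgn, h.neg_one_zpow]

theorem sgn_add_aux (m n : ℤ) : sgn (m + n) = sgn m * sgn n := by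
  simp [sgn, zpow_add]

theorem sgn_one_aux : sgn 1 = -1 := sgn_odd_aux odd_one

theorem sgn_two_aux : sgn 2 = 1 := sgn_even_aux even_two

theorem sgn_cases_aux (i j : ℤ) :
    (sgn i = 1 ∧ sgn j = 1 ∧ sgn (i * j) = 1) ∨ (sgn i = 1 ∧ sgn j = -1 ∧ sgn (i * j) = 1) ∨
    (sgn i = -1 ∧ sgn j = 1 ∧ sgn (i * j) = 1) ∨
    (sgn i = -1 ∧ sgn j = -1 ∧ sgn (i * j) = -1) := by
  rcases Int.even_or_odd i with hi | hi <;> rcases Int.even_or_odd j with hj | hj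
  · exact Or.inl ⟨sgn_even_aux hi, sgn_even_aux hj, sgn_even_aux (hi.mul_right j)⟩
  · exact Or.inr (Or.inl ⟨sgn_even_aux hi, sgn_odd_aux hj, sgn_even_aux (hi.mul_right j)⟩)
  · exact Or.inr (Or.inr (Or.inl ⟨sgn_odd_aux hi, sgn_even_aux hj, sgn_even_aux (hj.mul_left i)⟩))
  · exact Or.inr (Or.inr (Or.inr ⟨sgn_odd_aux hi, sgn_odd_aux hj, sgn_odd_aux (hi.mul hj)⟩))

/-- Let `A` be a BV algebra, `B` a graded `R`-module, `E : A → B` of degree `0` and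
`M : B → A` of degree `+1` with `E ∘ M = 0` and `M ∘ E = Δ`.  Then (i) `Δ ∘ M = 0`
and `E ∘ Δ = 0`; (ii) `M[a,b] = {Ma, Mb}`, so `M` is a morphism of brackets;
(iii) the string bracket `[a,b] = (−1)^{|a|+1} E(Ma · Mb)` is graded antisymmetric
and satisfies the graded Jacobi identity. -/
theorem string_bracket_lie {R A B : Type*} [CommRing R]
    [AddCommGroup A] [Module R A] [AddCommGroup B] [Module R B]
    (S : GradedBV R A) (Bdeg : ℤ → Submodule R B)
    (E : A →ₗ[R] B) (M : B →ₗ[R] A)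
    (hE_deg : ∀ {i : ℤ} {a : A}, a ∈ S.deg i → E a ∈ Bdeg i)
    (hM_deg : ∀ {i : ℤ} {b : B}, b ∈ Bdeg i → M b ∈ S.deg (i + 1))
    (hEM : ∀ b : B, E (M b) = 0)
    (hME : ∀ a : A, M (E a) = S.Δ a) :
    (∀ b : B, S.Δ (M b) = 0) ∧
    (∀ a : A, E (S.Δ a) = 0) ∧
    (∀ {i j : ℤ} {a b : B}, a ∈ Bdeg i → b ∈ Bdeg j →
      M (stringBracket S E M i a b) = S.bracket (i + 1) (M a) (M b)) ∧
    (∀ {i j : ℤ} {a b : B}, a ∈ Bdeg i → b ∈ Bdeg j →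
      stringBracket S E M i a b = -(sgn (i * j) • stringBracket S E M j b a)) ∧
    (∀ {i j k : ℤ} {a b c : B}, a ∈ Bdeg i → b ∈ Bdeg j → c ∈ Bdeg k →
      stringBracket S E M i a (stringBracket S E M j b c)
        = stringBracket S E M (i + j + 2) (stringBracket S E M i a b) c
          + sgn (i * j) • stringBracket S E M j b (stringBracket S E M i a c)) := by
  have hΔM : ∀ b : B, S.Δ (M b) = 0 := fun b => by rw [← hME, hEM, map_zero]
  have hEΔ : ∀ a : A, E (S.Δ a) = 0 := fun a => by rw [← hME, hEM]
  refine ⟨hΔM, hEΔ, ?_, ?_, ?_⟩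
  · intro i j a b _ _
    simp [stringBracket, GradedBV.bracket, hME, hΔM]
  · intro i j a b ha hb
    have e : (i + 1) * (j + 1) = i * j + i + j + 1 := by ring
    have h := S.mul_comm' (hM_deg ha) (hM_deg hb)
    rw [e] at h
    simp only [stringBracket, h, map_zsmul, sgn_add_aux, sgn_one_aux]
    rcases sgn_cases_aux i j with h | h | h | h <;> obtain ⟨h1, h2, h3⟩ := h <;>
      simp [h1, h2, h3]
  · intro i j k a b c ha hb hc
    have e : (i + 1 + 1) * (j + 1) = i * j + i + j + j + 2 := by ring
    have h := congrArg E (S.deviation_deriv (hM_deg ha) (hM_deg hb) (hM_deg hc))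
    rw [e] at h
    simp only [hΔM, map_zero, LinearMap.zero_apply, smul_zero, sub_zero, map_sub, map_add,
      map_zsmul, hEΔ, zero_sub, sgn_add_aux, sgn_one_aux, sgn_two_aux] at h
    simp only [stringBracket, map_zsmul, hME, sgn_add_aux, sgn_one_aux, sgn_two_aux,
      LinearMap.smul_apply]
    rcases sgn_cases_aux i j with h' | h' | h' | h' <;> obtain ⟨h1, h2, h3⟩ := h' <;>
      simp [h1, h2, h3] at h ⊢ <;> grind
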